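/- Let k be an algebraically closed field of characteristic different from 2 and 3, and fix M = 3 or M = 4. Suppose (f₁, g₁) and (f₂, g₂) are two pairs of polynomials in k[T] with deg(fᵢ) = 2M, deg(gᵢ) = 3M, fᵢ³ ≠ gᵢ², and deg(fᵢ³ − gᵢ²) = M + 1 for i = 1, 2. Then the two pairs are related by an affine transformation of T and scaling: there exist c, a ∈ k with c ≠ 0, a ≠ 0, and b ∈ k such that f₂(T) = c² · f₁(aT + b) and g₂(T) = c³ · g₁(aT + b). -/

import Mathlib

open Polynomial

namespace DS

variable {k : Type*} [Field k]

theorem rep1 {p : k[X]} (h : p.natDegree ≤ 1) : ∃ a b : k, p = C a * X + C b :=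
  exists_eq_X_add_C_of_natDegree_le_one h

theorem rep_succ {p : k[X]} {n : ℕ} (h : p.natDegree ≤ n + 1) :
    ∃ (a : k) (q : k[X]), q.natDegree ≤ n ∧ p = C a * X ^ (n + 1) + q := by
  refine ⟨p.coeff (n + 1), p - C (p.coeff (n + 1)) * X ^ (n + 1), ?_, by ring⟩
  rw [natDegree_le_iff_coeff_eq_zero]
  intro N hN
  rw [coeff_sub, coeff_C_mul, coeff_X_pow]
  rcases eq_or_ne N (n + 1) with rfl | hne
  · simp
  · rw [if_neg hne, coeff_eq_zero_of_natDegree_lt (by omega)]; simp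

theorem rep_monic {p : k[X]} {n : ℕ} (hm : p.Monic) (h : p.natDegree = n + 1) :
    ∃ (q : k[X]), q.natDegree ≤ n ∧ p = X ^ (n + 1) + q := by
  refine ⟨p - X ^ (n + 1), ?_, by ring⟩
  rw [natDegree_le_iff_coeff_eq_zero]
  intro N hN
  rw [coeff_sub, coeff_X_pow]
  rcases eq_or_ne N (n + 1) with rfl | hne
  · have := hm.coeff_natDegree
    rw [h] at this
    simp [this]
  · rw [if_neg hne, coeff_eq_zero_of_natDegree_lt (by omega)]; simp

theorem rep2 {p : k[X]} (h : p.natDegree ≤ 2) :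
    ∃ a b c : k, p = C a * X ^ 2 + C b * X + C c := by
  obtain ⟨a, q, hq, rfl⟩ := rep_succ h
  obtain ⟨b, c, rfl⟩ := rep1 hq
  exact ⟨a, b, c, by ring⟩

theorem rep3 {p : k[X]} (h : p.natDegree ≤ 3) :
    ∃ a b c d : k, p = C a * X ^ 3 + C b * X ^ 2 + C c * X + C d := by
  obtain ⟨a, q, hq, rfl⟩ := rep_succ h
  obtain ⟨b, c, d, rfl⟩ := rep2 hq
  exact ⟨a, b, c, d, by ring⟩

theorem coeffs_zero {e9 e8 e7 e6 e5 e4 e3 e2 e1 e0 : k}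
    (h : C e9 * X ^ 9 + C e8 * X ^ 8 + C e7 * X ^ 7 + C e6 * X ^ 6 + C e5 * X ^ 5
      + C e4 * X ^ 4 + C e3 * X ^ 3 + C e2 * X ^ 2 + C e1 * X + C e0 = 0) :
    e9 = 0 ∧ e8 = 0 ∧ e7 = 0 ∧ e6 = 0 ∧ e5 = 0 ∧ e4 = 0 ∧ e3 = 0 ∧ e2 = 0 ∧ e1 = 0 ∧ e0 = 0 := by
  have H := fun n => congrArg (fun p => coeff p n) h
  have H0 := H 0
  have H1 := H 1
  have H2 := H 2
  have H3 := H 3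
  have H4 := H 4
  have H5 := H 5
  have H6 := H 6
  have H7 := H 7
  have H8 := H 8
  have H9 := H 9
  simp [coeff_X, coeff_C] at H0 H1 H2 H3 H4 H5 H6 H7 H8 H9
  simp [*]

/-- degree bookkeeping; `M = N + 3`. -/
theorem core_deg (h2 : (2 : k) ≠ 0) (N : ℕ) (hN : N ≤ 1) (h u v : k[X]) (hh : h.Monic)
    (hhd : h.natDegree = N + 3) (hu : u.natDegree ≤ N + 2) (hv : v.natDegree < 3 * (N + 3))
    (hne : (h ^ 2 + 2 * u) ^ 3 - (h ^ 3 + 3 * h * u + v) ^ 2 ≠ 0)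
    (hd : ((h ^ 2 + 2 * u) ^ 3 - (h ^ 3 + 3 * h * u + v) ^ 2).natDegree ≤ N + 4) :
    u ≠ 0 ∧ v.natDegree ≤ N + 1 ∧ (3 * u ^ 2 - 2 * h * v).natDegree ≤ N ∧
      (h ^ 2 * (3 * u ^ 2 - 2 * h * v) - u ^ 3).natDegree ≤ N + 4 := by
  have cn : ∀ (n : ℕ) (p : k[X]) (m : ℕ), p.natDegree ≤ m →
      ((n : k[X]) * p).natDegree ≤ m := by
    intro n p m hp
    refine (natDegree_mul_le_of_le (natDegree_natCast n).le hp).trans (by omega)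
  have c2 := cn 2
  have c3 := cn 3
  have c6 := cn 6
  have c8 := cn 8
  push_cast at c2 c3 c6 c8
  set D := (h ^ 2 + 2 * u) ^ 3 - (h ^ 3 + 3 * h * u + v) ^ 2 with hD
  have h20 : (2 : k[X]) ≠ 0 := by
    have : (C (2 : k)) ≠ 0 := C_ne_zero.mpr h2
    rwa [map_ofNat] at this
  have h0 : h ≠ 0 := hh.ne_zero
  have hhl : h.natDegree ≤ N + 3 := hhd.le
  have n2 : (2 * h ^ 3 : k[X]).natDegree = 3 * (N + 3) := by
    rw [natDegree_mul h20 (pow_ne_zero _ h0), natDegree_pow, hhd]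
    have : (2 : k[X]).natDegree = 0 := natDegree_ofNat 2
    omega
  have d1 : (6 * (h * u) + v).natDegree < 3 * (N + 3) := by
    have : (6 * (h * u)).natDegree ≤ 2 * N + 5 :=
      c6 _ _ ((natDegree_mul_le_of_le hhl hu).trans (by omega))
    refine lt_of_le_of_lt (natDegree_add_le _ _) (max_lt (by omega) hv)
  have d2 : (2 * h ^ 3 + (6 * (h * u) + v)).natDegree = 3 * (N + 3) := by
    rw [natDegree_add_eq_left_of_natDegree_lt (by omega), n2]
  have d20 : (2 * h ^ 3 + (6 * (h * u) + v)) ≠ 0 := by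
    intro hz; rw [hz] at d2; simp at d2
  have e1 : v * (2 * h ^ 3 + (6 * (h * u) + v)) = 3 * (h ^ 2 * u ^ 2) + 8 * u ^ 3 - D := by
    rw [hD]; ring
  have hv1 : v.natDegree ≤ N + 1 := by
    by_cases hv0 : v = 0
    · simp [hv0]
    have t : (v * (2 * h ^ 3 + (6 * (h * u) + v))).natDegree ≤ 4 * N + 10 := by
      rw [e1]
      refine natDegree_sub_le_of_le (natDegree_add_le_of_degree_le (c3 _ _ ?_) (c8 _ _ ?_)) ?_ |>.trans (max_self _).le
      · exact (natDegree_mul_le_of_le (natDegree_pow_le_of_le 2 hhl)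
          (natDegree_pow_le_of_le 2 hu)).trans (by omega)
      · exact (natDegree_pow_le_of_le 3 hu).trans (by omega)
      · omega
    rw [natDegree_mul hv0 d20, d2] at t
    omega
  set w := 3 * u ^ 2 - 2 * h * v with hw
  have e2 : h ^ 2 * w = D - 8 * u ^ 3 + 6 * (h * (u * v)) + v ^ 2 := by
    rw [hD, hw]; ring
  have hw1 : w.natDegree ≤ N := by
    by_cases hw0 : w = 0
    · simp [hw0]
    have t : (h ^ 2 * w).natDegree ≤ 3 * N + 6 := by
      rw [e2]
      refine natDegree_add_le_of_degree_le (natDegree_add_le_of_degree_le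
        (natDegree_sub_le_of_le ?_ (c8 _ _ ?_) |>.trans (max_self _).le) (c6 _ _ ?_)) ?_
      · omega
      · exact (natDegree_pow_le_of_le 3 hu).trans (by omega)
      · exact (natDegree_mul_le_of_le hhl (natDegree_mul_le_of_le hu hv1)).trans (by omega)
      · exact (natDegree_pow_le_of_le 2 hv1).trans (by omega)
    rw [natDegree_mul (pow_ne_zero _ h0) hw0, natDegree_pow, hhd] at t
    omega
  refine ⟨?_, hv1, hw1, ?_⟩
  · intro hu0
    have hv0 : v = 0 := by
      by_contra hv0
      have e : w = -(2 * (h * v)) := by rw [hw, hu0]; ring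
      rw [e, natDegree_neg, natDegree_mul h20 (mul_ne_zero h0 hv0), natDegree_mul h0 hv0, hhd] at hw1
      omega
    apply hne
    rw [hD, hu0, hv0]; ring
  · have e : h ^ 2 * w - u ^ 3 = D - 3 * (u * w) + v ^ 2 := by
      rw [hD, hw]; ring
    rw [e]
    refine natDegree_add_le_of_degree_le
        (natDegree_sub_le_of_le hd (c3 _ _ ?_) |>.trans (max_self _).le) ?_
    · exact (natDegree_mul_le_of_le hu hw1).trans (by omega)
    · exact (natDegree_pow_le_of_le 2 hv1).trans (by omega)

theorem core3 [IsAlgClosed k] (h2 : (2 : k) ≠ 0) (h3 : (3 : k) ≠ 0) (x1 x0 : k) (h u v : k[X])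
    (hh : h = X ^ 3 + C x1 * X + C x0) (hu0 : u ≠ 0)
    (hu : u.natDegree ≤ 2) (hv : v.natDegree ≤ 1) (hw : (3 * u ^ 2 - 2 * h * v).natDegree ≤ 0)
    (hd : (h ^ 2 * (3 * u ^ 2 - 2 * h * v) - u ^ 3).natDegree ≤ 4) :
    ∃ r : k, r ≠ 0 ∧ h.comp (C r * X) = C (r ^ 3) * (X ^ 3 + 2 * X) ∧
      u.comp (C r * X) = C (r ^ 6) * (3 * X ^ 2 + 3) ∧
      v.comp (C r * X) = C (r ^ 9) * (C (27 / 2) * X) := by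
  obtain ⟨u2, u1, u0, rfl⟩ := rep2 hu
  obtain ⟨v1, v0, rfl⟩ := rep1 hv
  obtain ⟨w, hw⟩ : ∃ w : k, _ = C w := ⟨_, eq_C_of_natDegree_le_zero hw⟩
  rw [hw] at hd
  obtain ⟨d4, q, hq, hd⟩ := rep_succ hd
  obtain ⟨d3, d2, d1, d0, rfl⟩ := rep3 hq
  subst hh
  obtain ⟨-, -, -, -, -, E4, E3, E2, E1, E0⟩ := coeffs_zero (k := k) (e9 := 0) (e8 := 0) (e7 := 0)
    (e6 := 0) (e5 := 0) (e4 := 3*u2^2-2*v1) (e3 := 6*u2*u1-2*v0) (e2 := 3*u1^2+6*u2*u0-2*x1*v1)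
    (e1 := 6*u1*u0-2*x1*v0-2*x0*v1) (e0 := 3*u0^2-2*x0*v0-w) (by
      simp only [map_add, map_sub, map_mul, map_pow, map_ofNat, map_zero]
      linear_combination hw)
  obtain ⟨-, -, -, F6, F5, -⟩ := coeffs_zero (k := k) (e9 := 0) (e8 := 0) (e7 := 0)
    (e6 := w - u2^3) (e5 := -3*u2^2*u1) (e4 := 2*x1*w - 3*u2^2*u0-3*u2*u1^2 - d4)
    (e3 := 2*x0*w-6*u2*u1*u0-u1^3-d3)
    (e2 := x1^2*w-3*u2*u0^2-3*u1^2*u0-d2)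
    (e1 := 2*x1*x0*w-3*u1*u0^2-d1) (e0 := x0^2*w-u0^3-d0) (by
      simp only [map_add, map_sub, map_mul, map_pow, map_ofNat, map_zero, map_neg]
      linear_combination hd)
  have a2 : u2 ≠ 0 := by
    rintro rfl
    have hv1 : v1 = 0 := by
      have : 2 * v1 = 0 := by linear_combination -E4
      simpa [h2] using this
    have hv0 : v0 = 0 := by
      have : 2 * v0 = 0 := by linear_combination -E3
      simpa [h2] using this
    subst hv1 hv0
    have hu1 : u1 = 0 := by
      have : 3 * u1 ^ 2 = 0 := by linear_combination E2
      simpa [h3] using this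
    have hu0' : u0 = 0 := by
      have : 3 * u0 ^ 2 = 0 := by linear_combination E0 + F6
      simpa [h3] using this
    subst hu1 hu0'
    simp at hu0
  have hu1 : u1 = 0 := by
    have : 3 * u2 ^ 2 * u1 = 0 := by linear_combination -F5
    simpa [h3, a2] using this
  subst hu1
  have hv0 : v0 = 0 := by
    have : 2 * v0 = 0 := by linear_combination -E3
    simpa [h2] using this
  subst hv0
  have hx0 : x0 = 0 := by
    have : 3 * u2 ^ 2 * x0 = 0 := by linear_combination x0 * E4 - E1
    simpa [h3, a2] using this
  subst hx0
  obtain ⟨e, rfl⟩ : ∃ e, u0 = e * u2 := ⟨u0 / u2, by field_simp⟩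
  have hx1 : x1 = 2 * e := by
    have : 3 * u2 ^ 2 * (x1 - 2 * e) = 0 := by linear_combination x1 * E4 - E2
    have : x1 - 2 * e = 0 := by simpa [h3, a2] using this
    linear_combination this
  subst hx1
  have hu2 : u2 = 3 * e ^ 2 := by
    have : u2 ^ 2 * (u2 - 3 * e ^ 2) = 0 := by linear_combination -E0 - F6
    have : u2 - 3 * e ^ 2 = 0 := by simpa [a2] using this
    linear_combination this
  subst hu2
  obtain ⟨r, rfl⟩ := IsAlgClosed.exists_pow_nat_eq e (n := 2) (by norm_num)
  have hv1 : v1 = r ^ 8 * (27 / 2) := by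
    field_simp
    linear_combination -E4
  subst hv1
  refine ⟨r, ?_, ?_, ?_, ?_⟩
  · rintro rfl; simp at a2
  · simp only [add_comp, mul_comp, pow_comp, C_comp, X_comp]
    simp only [map_mul, map_pow, map_ofNat, map_zero]
    ring
  · simp only [add_comp, mul_comp, pow_comp, C_comp, X_comp]
    simp only [map_mul, map_pow, map_ofNat, map_zero]
    ring
  · simp only [add_comp, mul_comp, pow_comp, C_comp, X_comp]
    simp only [map_mul, map_pow, map_ofNat, map_zero]
    ring

theorem core4 (h2 : (2 : k) ≠ 0) (h3 : (3 : k) ≠ 0) (y z t : k) (h u v : k[X])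
    (hh : h = X ^ 4 + C y * X ^ 2 + C z * X + C t) (hu0 : u ≠ 0)
    (hu : u.natDegree ≤ 3) (hv : v.natDegree ≤ 2) (hw : (3 * u ^ 2 - 2 * h * v).natDegree ≤ 1)
    (hd : (h ^ 2 * (3 * u ^ 2 - 2 * h * v) - u ^ 3).natDegree ≤ 5) :
    ∃ r m : k, r ≠ 0 ∧ h.comp (C r * X + C m) = C (r ^ 4) * (X ^ 4 + 3 * X ^ 3 + 6 * X ^ 2 + 7 * X + 4) ∧
      u.comp (C r * X + C m) = C (r ^ 8) * (3 * (X ^ 3 + 2 * X ^ 2 + 3 * X + 2)) ∧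
      v.comp (C r * X + C m) = C (r ^ 12) * (C (27 / 2) * (X ^ 2 + X + 1)) := by
  obtain ⟨A, B, G, D, rfl⟩ := rep3 hu
  obtain ⟨v2, v1, v0, rfl⟩ := rep2 hv
  obtain ⟨s, d, hw⟩ := rep1 hw
  rw [hw] at hd
  obtain ⟨d5, q, hq, hd⟩ := rep_succ hd
  obtain ⟨d4, q', hq', rfl⟩ := rep_succ hq
  obtain ⟨d3, d2, d1, d0, rfl⟩ := rep3 hq'
  subst hh
  obtain ⟨-, -, -, E6, E5, E4, E3, E2, E1, E0⟩ := coeffs_zero (k := k) (e9 := 0) (e8 := 0) (e7 := 0)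
    (e6 := 3*A^2-2*v2) (e5 := 6*A*B-2*v1) (e4 := 3*B^2+6*A*G-2*(v0+y*v2))
    (e3 := 6*A*D+6*B*G-2*(y*v1+z*v2)) (e2 := 3*G^2+6*B*D-2*(t*v2+z*v1+y*v0))
    (e1 := 6*G*D-2*(t*v1+z*v0)-s) (e0 := 3*D^2-2*t*v0-d) (by
      simp only [map_add, map_sub, map_mul, map_pow, map_ofNat, map_zero]
      linear_combination hw)
  obtain ⟨F9, F8, F7, F6, -⟩ := coeffs_zero (k := k) (e9 := s - A^3) (e8 := d-3*A^2*B)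
    (e7 := 2*y*s-(3*A^2*G+3*A*B^2))
    (e6 := 2*y*d+2*z*s-(3*A^2*D+6*A*B*G+B^3))
    (e5 := 2*z*d+(y^2+2*t)*s-(6*A*B*D+3*A*G^2+3*B^2*G) - d5)
    (e4 := (y^2+2*t)*d+2*y*z*s-(6*A*G*D+3*B^2*D+3*B*G^2) - d4)
    (e3 := 2*y*z*d+(z^2+2*y*t)*s-(6*B*G*D+3*A*D^2+G^3) - d3)
    (e2 := (z^2+2*y*t)*d+2*z*t*s-(3*B*D^2+3*G^2*D) - d2)
    (e1 := 2*z*t*d+t^2*s-3*G*D^2 - d1) (e0 := t^2*d-D^3 - d0) (by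
      simp only [map_add, map_sub, map_mul, map_pow, map_ofNat]
      linear_combination hd)
  have hA : A ≠ 0 := by
    rintro rfl
    have hs : s = 0 := by linear_combination F9
    have hd0 : d = 0 := by linear_combination F8
    subst hs hd0
    have hB : B = 0 := by
      have : B ^ 3 = 0 := by linear_combination -F6
      simpa using this
    subst hB
    have hv2 : v2 = 0 := by
      have : 2 * v2 = 0 := by linear_combination -E6
      simpa [h2] using this
    have hv1 : v1 = 0 := by
      have : 2 * v1 = 0 := by linear_combination -E5
      simpa [h2] using this
    subst hv2 hv1
    have hv0 : v0 = 0 := by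
      have : 2 * v0 = 0 := by linear_combination -E4
      simpa [h2] using this
    subst hv0
    have hG : G = 0 := by
      have : 3 * G ^ 2 = 0 := by linear_combination E2
      simpa [h3] using this
    have hD : D = 0 := by
      have : 3 * D ^ 2 = 0 := by linear_combination E0
      simpa [h3] using this
    subst hG hD
    simp at hu0
  obtain ⟨a, rfl⟩ : ∃ a, B = A * a := ⟨B / A, by field_simp⟩
  obtain ⟨b, rfl⟩ : ∃ b, G = A * b := ⟨G / A, by field_simp⟩
  obtain ⟨c, rfl⟩ : ∃ c, D = A * c := ⟨D / A, by field_simp⟩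
  have hs : s = A ^ 3 := by linear_combination F9
  have hd' : d = 3 * A ^ 3 * a := by linear_combination F8
  have hv2 : v2 = 3 * A ^ 2 / 2 := by field_simp; linear_combination -E6
  have hv1 : v1 = 3 * A ^ 2 * a := by
    have : 2 * (v1 - 3 * A ^ 2 * a) = 0 := by linear_combination -E5
    have : v1 - 3 * A ^ 2 * a = 0 := by simpa [h2] using this
    linear_combination this
  subst hs hd' hv1 hv2
  have hy : y = 3 * (b + a ^ 2) / 2 := by
    have : A ^ 3 * (2 * y - 3 * (b + a ^ 2)) = 0 := by linear_combination F7
    have : 2 * y - 3 * (b + a ^ 2) = 0 := by simpa [hA] using this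
    field_simp; linear_combination this
  subst hy
  have hv0 : v0 = 3 * A ^ 2 * (b - a ^ 2) / 4 := by
    have h4 : (4 : k) ≠ 0 := by
      have : (4 : k) = 2 * 2 := by norm_num
      rw [this]; exact mul_ne_zero h2 h2
    field_simp at E4 ⊢
    linear_combination -E4
  subst hv0
  have hz : z = (3 * c - 3 * a * b - 8 * a ^ 3) / 2 := by
    have : A ^ 3 * (2 * z - (3 * c - 3 * a * b - 8 * a ^ 3)) = 0 := by
      field_simp at F6
      linear_combination F6
    have : 2 * z - (3 * c - 3 * a * b - 8 * a ^ 3) = 0 := by simpa [hA] using this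
    field_simp; linear_combination this
  subst hz
  have h4 : (4 : k) ≠ 0 := by
    have : (4 : k) = 2 * 2 := by norm_num
    rw [this]; exact mul_ne_zero h2 h2
  have hc : c = - a * b - 2 * a ^ 3 := by
    have : 3 * A ^ 2 * (c - (- a * b - 2 * a ^ 3)) = 0 := by
      field_simp at E3
      linear_combination E3
    have : c - (- a * b - 2 * a ^ 3) = 0 := by simpa [hA, h3] using this
    linear_combination this
  subst hc
  have ht : t = (b ^ 2 + 16 * a ^ 2 * b + 43 * a ^ 4) / 4 := by
    have : 3 * A ^ 2 * (4 * t - (b ^ 2 + 16 * a ^ 2 * b + 43 * a ^ 4)) = 0 := by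
      field_simp at E2
      linear_combination -E2
    have : 4 * t - (b ^ 2 + 16 * a ^ 2 * b + 43 * a ^ 4) = 0 := by simpa [hA, h3] using this
    field_simp; linear_combination this
  subst ht
  have hA1 : A = - 3 * a * (b + 5 * a ^ 2) ^ 2 := by
    have : 4 * A ^ 2 * (A - (- 3 * a * (b + 5 * a ^ 2) ^ 2)) = 0 := by
      field_simp at E1
      linear_combination -E1
    have : A - (- 3 * a * (b + 5 * a ^ 2) ^ 2) = 0 := by simpa [hA, h4] using this
    linear_combination this
  have ha : a ≠ 0 := by rintro rfl; simp at hA1; exact hA hA1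
  have hb5 : b + 5 * a ^ 2 ≠ 0 := by intro h0; rw [h0] at hA1; simp at hA1; exact hA hA1
  have hb : b = 27 * a ^ 2 := by
    have : 2 * 3 * A ^ 2 * ((b + 5 * a ^ 2) ^ 2 * (b - 27 * a ^ 2)) = 0 := by
      field_simp at E0
      linear_combination -E0 - 48 * A ^ 2 * a * hA1
    have : b - 27 * a ^ 2 = 0 := by simpa [hA, h2, h3, hb5] using this
    linear_combination this
  subst hb
  have hA2 : A = - 3 * 1024 * a ^ 5 := by rw [hA1]; ring
  clear hA1
  subst hA2
  refine ⟨- 4 * a, - 3 * a, ?_, ?_, ?_, ?_⟩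
  · have : (-4 * a : k) = 4 * a * (-1) := by ring
    rw [this]; exact mul_ne_zero (mul_ne_zero h4 ha) (by simp)
  · have i1 : (3 * (27 * a ^ 2 + a ^ 2) / 2 : k) = 42 * a ^ 2 := by field_simp; ring
    have i2 : ((3 * (-a * (27 * a ^ 2) - 2 * a ^ 3) - 3 * a * (27 * a ^ 2) - 8 * a ^ 3) / 2 : k)
      = - 88 * a ^ 3 := by field_simp; ring
    have i3 : (((27 * a ^ 2) ^ 2 + 16 * a ^ 2 * (27 * a ^ 2) + 43 * a ^ 4) / 4 : k)
      = 301 * a ^ 4 := by field_simp; ring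
    rw [i1, i2, i3]
    simp only [add_comp, mul_comp, pow_comp, C_comp, X_comp]
    simp only [map_mul, map_pow, map_ofNat, map_neg]
    ring
  · simp only [add_comp, mul_comp, pow_comp, C_comp, X_comp]
    simp only [map_mul, map_pow, map_ofNat, map_neg, map_sub]
    ring
  · have i1 : (3 * (-3 * 1024 * a ^ 5) ^ 2 / 2 : k) = 27 / 2 * (1024 ^ 2 * a ^ 10) := by
      field_simp; ring
    have i2 : (3 * (-3 * 1024 * a ^ 5) ^ 2 * a : k) = 27 / 2 * (2 * 1024 ^ 2 * a ^ 11) := by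
      field_simp; ring
    have i3 : (3 * (-3 * 1024 * a ^ 5) ^ 2 * (27 * a ^ 2 - a ^ 2) / 4 : k)
      = 27 / 2 * (13 * 1024 ^ 2 * a ^ 12) := by
      field_simp; ring
    rw [i1, i2, i3]
    simp only [add_comp, mul_comp, pow_comp, C_comp, X_comp]
    generalize (27 / 2 : k) = e
    simp only [map_mul, map_pow, map_ofNat, map_neg]
    ring

theorem trans_deg (h u v : k[X]) (m : k) {n1 n2 n3 n4 : ℕ} (hu0 : u ≠ 0)
    (hu : u.natDegree ≤ n1) (hv : v.natDegree ≤ n2) (hw : (3 * u ^ 2 - 2 * h * v).natDegree ≤ n3)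
    (hd : (h ^ 2 * (3 * u ^ 2 - 2 * h * v) - u ^ 3).natDegree ≤ n4) :
    let h' := h.comp (X + C m)
    let u' := u.comp (X + C m)
    let v' := v.comp (X + C m)
    u' ≠ 0 ∧ u'.natDegree ≤ n1 ∧ v'.natDegree ≤ n2 ∧ (3 * u' ^ 2 - 2 * h' * v').natDegree ≤ n3 ∧
    (h' ^ 2 * (3 * u' ^ 2 - 2 * h' * v') - u' ^ 3).natDegree ≤ n4 := by
  intro h' u' v'
  have key : ∀ p : k[X], (p.comp (X + C m)).natDegree = p.natDegree := by
    intro p; rw [natDegree_comp, natDegree_X_add_C, mul_one]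
  have o2 : (2 : k[X]).comp (X + C m) = 2 := by
    have := C_comp (a := (2 : k)) (p := X + C m); rwa [map_ofNat] at this
  have o3 : (3 : k[X]).comp (X + C m) = 3 := by
    have := C_comp (a := (3 : k)) (p := X + C m); rwa [map_ofNat] at this
  refine ⟨?_, by rwa [key], by rwa [key], ?_, ?_⟩
  · intro h0
    apply hu0
    have := congrArg (fun p => p.comp (X - C m)) h0
    simpa [u', comp_assoc] using this
  · rw [← key] at hw
    simpa [o2, o3, h', u', v'] using hw
  · rw [← key] at hd
    simpa [o2, o3, h', u', v'] using hd

/-- Monic pairs, `M = 3`. -/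
theorem normal3 [IsAlgClosed k] (h2 : (2 : k) ≠ 0) (h3 : (3 : k) ≠ 0) (F G : k[X])
    (hF : F.Monic) (hG : G.Monic) (hFd : F.natDegree = 6) (hGd : G.natDegree = 9)
    (hne : F ^ 3 - G ^ 2 ≠ 0) (hd : (F ^ 3 - G ^ 2).natDegree ≤ 4) :
    ∃ c r b : k, c ≠ 0 ∧ r ≠ 0 ∧
      F.comp (C r * X + C b) = C (c ^ 2) * ((X ^ 3 + 2 * X) ^ 2 + 2 * (3 * X ^ 2 + 3)) ∧
      G.comp (C r * X + C b) = C (c ^ 3) * ((X ^ 3 + 2 * X) ^ 3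
        + 3 * (X ^ 3 + 2 * X) * (3 * X ^ 2 + 3) + C (27 / 2) * X) := by
  obtain ⟨q, hq, hFe⟩ := rep_monic hF hFd
  obtain ⟨f5, qb, hqb, rfl⟩ := rep_succ hq
  obtain ⟨f4, qc, hqc, rfl⟩ := rep_succ hqb
  obtain ⟨f3, f2, f1, f0, rfl⟩ := rep3 hqc
  obtain ⟨p, rfl⟩ : ∃ p, f5 = 2 * (3 * p) := ⟨f5 / 2 / 3, by field_simp⟩
  obtain ⟨x1, rfl⟩ : ∃ x, f4 = 2 * x + (3 * p) ^ 2 := ⟨(f4 - (3 * p) ^ 2) / 2, by field_simp; ring⟩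
  obtain ⟨x0, rfl⟩ : ∃ x, f3 = 2 * x + 2 * (3 * p) * x1 :=
    ⟨(f3 - 2 * (3 * p) * x1) / 2, by field_simp; ring⟩
  obtain ⟨u2, rfl⟩ : ∃ x, f2 = 2 * x + x1 ^ 2 + 2 * (3 * p) * x0 :=
    ⟨(f2 - x1 ^ 2 - 2 * (3 * p) * x0) / 2, by field_simp; ring⟩
  obtain ⟨u1, rfl⟩ : ∃ x, f1 = 2 * x + 2 * x1 * x0 := ⟨(f1 - 2 * x1 * x0) / 2, by field_simp; ring⟩
  obtain ⟨u0, rfl⟩ : ∃ x, f0 = 2 * x + x0 ^ 2 := ⟨(f0 - x0 ^ 2) / 2, by field_simp; ring⟩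
  obtain ⟨h, hh⟩ : ∃ h : k[X], h = X ^ 3 + C (3 * p) * X ^ 2 + C x1 * X + C x0 := ⟨_, rfl⟩
  obtain ⟨u, hu⟩ : ∃ u : k[X], u = C u2 * X ^ 2 + C u1 * X + C u0 := ⟨_, rfl⟩
  have hFhu : F = h ^ 2 + 2 * u := by
    rw [hFe, hh, hu]
    simp only [map_add, map_mul, map_pow, map_ofNat]
    ring
  clear hFe
  have hhd : h.natDegree = 3 := by rw [hh]; compute_degree!
  have hhm : h.Monic := by rw [Monic.def, leadingCoeff, hhd, hh]; generalize _ * p = P; simp [coeff_X, coeff_C]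
  have hud : u.natDegree ≤ 2 := by rw [hu]; compute_degree
  obtain ⟨v, hv⟩ : ∃ v, v = G - h ^ 3 - 3 * h * u := ⟨_, rfl⟩
  have hGv : G = h ^ 3 + 3 * h * u + v := by rw [hv]; ring
  have hvd : v.natDegree < 3 * (0 + 3) := by
    obtain ⟨q1, hq1, e1⟩ := rep_monic hG hGd
    obtain ⟨q2, hq2, e2⟩ := rep_monic (n := 8) (hhm.pow 3) (by rw [natDegree_pow, hhd])
    rw [hv, e1, e2]
    have : X ^ (8 + 1) + q1 - (X ^ (8 + 1) + q2) - 3 * h * u = q1 - q2 - C 3 * (h * u) := by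
      rw [map_ofNat]; ring
    rw [this]
    have h5 : (C 3 * (h * u)).natDegree ≤ 8 :=
      (natDegree_C_mul_le _ _).trans ((natDegree_mul_le_of_le hhd.le hud).trans (by norm_num))
    have := natDegree_sub_le_of_le (natDegree_sub_le_of_le hq1 hq2) h5
    simp at this
    omega
  clear hv
  subst hFhu hGv
  obtain ⟨c1, c2, c3, c4⟩ := core_deg h2 0 (by norm_num) h u v hhm hhd hud hvd hne hd
  obtain ⟨d1, d2, d3, d4, d5⟩ := trans_deg h u v (-p) c1 hud c2 c3 c4
  obtain ⟨r, hr, e1, e2, e3⟩ := core3 h2 h3 (x1 - 3 * p ^ 2) (x0 - x1 * p + 2 * p ^ 3) _ _ _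
    (by
      rw [hh]
      simp only [add_comp, mul_comp, pow_comp, C_comp, X_comp]
      simp only [map_add, map_sub, map_mul, map_pow, map_ofNat, map_neg]
      ring) d1 d2 d3 d4 d5
  have o2 : (2 : k[X]).comp (C r * X + C (-p)) = 2 := by
    have := C_comp (a := (2 : k)) (p := C r * X + C (-p)); rwa [map_ofNat] at this
  have o3 : (3 : k[X]).comp (C r * X + C (-p)) = 3 := by
    have := C_comp (a := (3 : k)) (p := C r * X + C (-p)); rwa [map_ofNat] at this
  rw [comp_assoc, add_comp, X_comp, C_comp] at e1 e2 e3
  refine ⟨r ^ 3, r, -p, pow_ne_zero _ hr, hr, ?_, ?_⟩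
  · simp only [add_comp, mul_comp, pow_comp, o2, e1, e2, map_pow]
    ring
  · simp only [add_comp, mul_comp, pow_comp, o3, e1, e2, e3, map_pow]
    ring

/-- Monic pairs, `M = 4`. -/
theorem normal4 (h2 : (2 : k) ≠ 0) (h3 : (3 : k) ≠ 0) (F G : k[X])
    (hF : F.Monic) (hG : G.Monic) (hFd : F.natDegree = 8) (hGd : G.natDegree = 12)
    (hne : F ^ 3 - G ^ 2 ≠ 0) (hd : (F ^ 3 - G ^ 2).natDegree ≤ 5) :
    ∃ c r b : k, c ≠ 0 ∧ r ≠ 0 ∧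
      F.comp (C r * X + C b) = C (c ^ 2) * ((X ^ 4 + 3 * X ^ 3 + 6 * X ^ 2 + 7 * X + 4) ^ 2
        + 2 * (3 * (X ^ 3 + 2 * X ^ 2 + 3 * X + 2))) ∧
      G.comp (C r * X + C b) = C (c ^ 3) * ((X ^ 4 + 3 * X ^ 3 + 6 * X ^ 2 + 7 * X + 4) ^ 3
        + 3 * (X ^ 4 + 3 * X ^ 3 + 6 * X ^ 2 + 7 * X + 4) * (3 * (X ^ 3 + 2 * X ^ 2 + 3 * X + 2))
        + C (27 / 2) * (X ^ 2 + X + 1)) := by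
  have h4 : (4 : k) ≠ 0 := by
    have : (4 : k) = 2 * 2 := by norm_num
    rw [this]; exact mul_ne_zero h2 h2
  obtain ⟨qa, hqa, hFe⟩ := rep_monic hF hFd
  obtain ⟨f7, qb, hqb, rfl⟩ := rep_succ hqa
  obtain ⟨f6, qc, hqc, rfl⟩ := rep_succ hqb
  obtain ⟨f5, qd, hqd, rfl⟩ := rep_succ hqc
  obtain ⟨f4, qe, hqe, rfl⟩ := rep_succ hqd
  obtain ⟨f3, f2, f1, f0, rfl⟩ := rep3 hqe
  obtain ⟨p, rfl⟩ : ∃ p, f7 = 2 * (4 * p) := ⟨f7 / 2 / 4, by field_simp⟩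
  obtain ⟨x2, rfl⟩ : ∃ x, f6 = 2 * x + (4 * p) ^ 2 := ⟨(f6 - (4 * p) ^ 2) / 2, by field_simp; ring⟩
  obtain ⟨x1, rfl⟩ : ∃ x, f5 = 2 * x + 2 * (4 * p) * x2 :=
    ⟨(f5 - 2 * (4 * p) * x2) / 2, by field_simp; ring⟩
  obtain ⟨x0, rfl⟩ : ∃ x, f4 = 2 * x + 2 * (4 * p) * x1 + x2 ^ 2 :=
    ⟨(f4 - 2 * (4 * p) * x1 - x2 ^ 2) / 2, by field_simp; ring⟩
  obtain ⟨u3, rfl⟩ : ∃ x, f3 = 2 * x + 2 * (4 * p) * x0 + 2 * x2 * x1 :=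
    ⟨(f3 - 2 * (4 * p) * x0 - 2 * x2 * x1) / 2, by field_simp; ring⟩
  obtain ⟨u2, rfl⟩ : ∃ x, f2 = 2 * x + x1 ^ 2 + 2 * x2 * x0 :=
    ⟨(f2 - x1 ^ 2 - 2 * x2 * x0) / 2, by field_simp; ring⟩
  obtain ⟨u1, rfl⟩ : ∃ x, f1 = 2 * x + 2 * x1 * x0 := ⟨(f1 - 2 * x1 * x0) / 2, by field_simp; ring⟩
  obtain ⟨u0, rfl⟩ : ∃ x, f0 = 2 * x + x0 ^ 2 := ⟨(f0 - x0 ^ 2) / 2, by field_simp; ring⟩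
  obtain ⟨h, hh⟩ : ∃ h : k[X], h = X ^ 4 + C (4 * p) * X ^ 3 + C x2 * X ^ 2 + C x1 * X + C x0 :=
    ⟨_, rfl⟩
  obtain ⟨u, hu⟩ : ∃ u : k[X], u = C u3 * X ^ 3 + C u2 * X ^ 2 + C u1 * X + C u0 := ⟨_, rfl⟩
  have hFhu : F = h ^ 2 + 2 * u := by
    rw [hFe, hh, hu]
    simp only [map_add, map_mul, map_pow, map_ofNat]
    ring
  clear hFe
  have hhd : h.natDegree = 4 := by rw [hh]; compute_degree!
  have hhm : h.Monic := by rw [Monic.def, leadingCoeff, hhd, hh]; generalize _ * p = P; simp [coeff_X, coeff_C]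
  have hud : u.natDegree ≤ 3 := by rw [hu]; compute_degree
  obtain ⟨v, hv⟩ : ∃ v, v = G - h ^ 3 - 3 * h * u := ⟨_, rfl⟩
  have hGv : G = h ^ 3 + 3 * h * u + v := by rw [hv]; ring
  have hvd : v.natDegree < 3 * (1 + 3) := by
    obtain ⟨q1, hq1, e1⟩ := rep_monic hG hGd
    obtain ⟨q2, hq2, e2⟩ := rep_monic (n := 11) (hhm.pow 3) (by rw [natDegree_pow, hhd])
    rw [hv, e1, e2]
    have : X ^ (11 + 1) + q1 - (X ^ (11 + 1) + q2) - 3 * h * u = q1 - q2 - C 3 * (h * u) := by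
      rw [map_ofNat]; ring
    rw [this]
    have h5 : (C 3 * (h * u)).natDegree ≤ 11 :=
      (natDegree_C_mul_le _ _).trans ((natDegree_mul_le_of_le hhd.le hud).trans (by norm_num))
    have := natDegree_sub_le_of_le (natDegree_sub_le_of_le hq1 hq2) h5
    simp at this
    omega
  clear hv
  subst hFhu hGv
  obtain ⟨c1, c2, c3, c4⟩ := core_deg h2 1 (by norm_num) h u v hhm hhd hud hvd hne hd
  obtain ⟨d1, d2, d3, d4, d5⟩ := trans_deg h u v (-p) c1 hud c2 c3 c4
  obtain ⟨r, m, hr, e1, e2, e3⟩ := core4 h2 h3 (x2 - 6 * p ^ 2) (x1 - 2 * x2 * p + 8 * p ^ 3)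
    (x0 - x1 * p + x2 * p ^ 2 - 3 * p ^ 4) _ _ _
    (by
      rw [hh]
      simp only [add_comp, mul_comp, pow_comp, C_comp, X_comp]
      simp only [map_add, map_sub, map_mul, map_pow, map_ofNat, map_neg]
      ring) d1 d2 d3 d4 d5
  have o2 : (2 : k[X]).comp (C r * X + C (m + -p)) = 2 := by
    have := C_comp (a := (2 : k)) (p := C r * X + C (m + -p)); rwa [map_ofNat] at this
  have o3 : (3 : k[X]).comp (C r * X + C (m + -p)) = 3 := by
    have := C_comp (a := (3 : k)) (p := C r * X + C (m + -p)); rwa [map_ofNat] at this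
  rw [comp_assoc, add_comp, X_comp, C_comp, add_assoc, ← C_add] at e1 e2 e3
  refine ⟨r ^ 4, r, m + -p, pow_ne_zero _ hr, hr, ?_, ?_⟩
  · simp only [add_comp, mul_comp, pow_comp, o2, e1, e2, map_pow]
    ring
  · simp only [add_comp, mul_comp, pow_comp, o3, e1, e2, e3, map_pow]
    ring

/-- Reduction to monic pairs. -/
theorem to_monic (M : ℕ) (hM : 1 ≤ M) (f g : k[X])
    (hf : f.natDegree = 2 * M) (hg : g.natDegree = 3 * M)
    (hne : f ^ 3 ≠ g ^ 2) (hd : (f ^ 3 - g ^ 2).natDegree = M + 1) :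
    ∃ (c : k) (F G : k[X]), c ≠ 0 ∧ F.Monic ∧ G.Monic ∧ F.natDegree = 2 * M ∧
      G.natDegree = 3 * M ∧ F ^ 3 - G ^ 2 ≠ 0 ∧ (F ^ 3 - G ^ 2).natDegree ≤ M + 1 ∧
      f = C (c ^ 2) * F ∧ g = C (c ^ 3) * G := by
  have hf0 : f ≠ 0 := by rintro rfl; simp at hf; omega
  have hg0 : g ≠ 0 := by rintro rfl; simp at hg; omega
  have hl : f.leadingCoeff ^ 3 = g.leadingCoeff ^ 2 := by
    have e : (f ^ 3 - g ^ 2).coeff (6 * M) = 0 := coeff_eq_zero_of_natDegree_lt (by omega)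
    have i1 : (f ^ 3).coeff (6 * M) = f.leadingCoeff ^ 3 := by
      rw [← leadingCoeff_pow, leadingCoeff, natDegree_pow, hf]; congr 1; omega
    have i2 : (g ^ 2).coeff (6 * M) = g.leadingCoeff ^ 2 := by
      rw [← leadingCoeff_pow, leadingCoeff, natDegree_pow, hg]; congr 1; omega
    rw [coeff_sub, i1, i2] at e
    linear_combination e
  have ha : f.leadingCoeff ≠ 0 := leadingCoeff_ne_zero.mpr hf0
  have hb : g.leadingCoeff ≠ 0 := leadingCoeff_ne_zero.mpr hg0
  obtain ⟨c, hc⟩ : ∃ c, c = g.leadingCoeff / f.leadingCoeff := ⟨_, rfl⟩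
  have hc0 : c ≠ 0 := by rw [hc]; exact div_ne_zero hb ha
  have hca : c ^ 2 = f.leadingCoeff := by
    rw [hc]; field_simp; linear_combination -hl
  have hcb : c ^ 3 = g.leadingCoeff := by
    rw [pow_succ, hca, hc]; field_simp
  have hF : f = C (c ^ 2) * (C (c ^ 2)⁻¹ * f) := by
    rw [← mul_assoc, ← C_mul, mul_inv_cancel₀ (pow_ne_zero _ hc0)]; simp
  have hG : g = C (c ^ 3) * (C (c ^ 3)⁻¹ * g) := by
    rw [← mul_assoc, ← C_mul, mul_inv_cancel₀ (pow_ne_zero _ hc0)]; simp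
  have e : (C (c ^ 2)⁻¹ * f) ^ 3 - (C (c ^ 3)⁻¹ * g) ^ 2 = C (c ^ 6)⁻¹ * (f ^ 3 - g ^ 2) := by
    rw [mul_pow, mul_pow, ← C_pow, ← C_pow, mul_sub]
    congr 3 <;> congr 1 <;> field_simp
  refine ⟨c, C (c ^ 2)⁻¹ * f, C (c ^ 3)⁻¹ * g, hc0, ?_, ?_, ?_, ?_, ?_, ?_, hF, hG⟩
  · rw [Monic.def, leadingCoeff_mul, leadingCoeff_C, hca, inv_mul_cancel₀ ha]
  · rw [Monic.def, leadingCoeff_mul, leadingCoeff_C, hcb, inv_mul_cancel₀ hb]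
  · rw [natDegree_C_mul (inv_ne_zero (pow_ne_zero _ hc0)), hf]
  · rw [natDegree_C_mul (inv_ne_zero (pow_ne_zero _ hc0)), hg]
  · rw [e]
    exact mul_ne_zero (C_ne_zero.mpr (inv_ne_zero (pow_ne_zero _ hc0))) (sub_ne_zero.mpr hne)
  · rw [e, natDegree_C_mul (inv_ne_zero (pow_ne_zero _ hc0)), hd]

theorem normal [IsAlgClosed k] (h2 : (2 : k) ≠ 0) (h3 : (3 : k) ≠ 0)
    (M : ℕ) (hM : M = 3 ∨ M = 4) :
    ∃ f₀ g₀ : k[X], ∀ f g : k[X], f.natDegree = 2 * M → g.natDegree = 3 * M →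
      f ^ 3 ≠ g ^ 2 → (f ^ 3 - g ^ 2).natDegree = M + 1 →
      ∃ c r b : k, c ≠ 0 ∧ r ≠ 0 ∧
        f.comp (C r * X + C b) = C (c ^ 2) * f₀ ∧ g.comp (C r * X + C b) = C (c ^ 3) * g₀ := by
  rcases hM with rfl | rfl
  · refine ⟨(X ^ 3 + 2 * X) ^ 2 + 2 * (3 * X ^ 2 + 3), (X ^ 3 + 2 * X) ^ 3
        + 3 * (X ^ 3 + 2 * X) * (3 * X ^ 2 + 3) + C (27 / 2) * X,
      fun f g hf hg hne hd => ?_⟩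
    · obtain ⟨c, F, G, hc, hF, hG, hFd, hGd, hne', hd', rfl, rfl⟩ :=
        to_monic 3 (by norm_num) f g hf hg hne hd
      obtain ⟨c', r, b, hc', hr, e1, e2⟩ := normal3 h2 h3 F G hF hG hFd hGd hne' hd'
      refine ⟨c * c', r, b, mul_ne_zero hc hc', hr, ?_, ?_⟩
      · rw [mul_comp, C_comp, e1, mul_pow, C_mul, ← mul_assoc (C _) (C _) _]
      · rw [mul_comp, C_comp, e2, mul_pow, C_mul, ← mul_assoc (C _) (C _) _]
  · refine ⟨(X ^ 4 + 3 * X ^ 3 + 6 * X ^ 2 + 7 * X + 4) ^ 2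
        + 2 * (3 * (X ^ 3 + 2 * X ^ 2 + 3 * X + 2)),
      (X ^ 4 + 3 * X ^ 3 + 6 * X ^ 2 + 7 * X + 4) ^ 3
        + 3 * (X ^ 4 + 3 * X ^ 3 + 6 * X ^ 2 + 7 * X + 4) * (3 * (X ^ 3 + 2 * X ^ 2 + 3 * X + 2))
        + C (27 / 2) * (X ^ 2 + X + 1),
      fun f g hf hg hne hd => ?_⟩
    · obtain ⟨c, F, G, hc, hF, hG, hFd, hGd, hne', hd', rfl, rfl⟩ :=
        to_monic 4 (by norm_num) f g hf hg hne hd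
      obtain ⟨c', r, b, hc', hr, e1, e2⟩ := normal4 h2 h3 F G hF hG hFd hGd hne' hd'
      refine ⟨c * c', r, b, mul_ne_zero hc hc', hr, ?_, ?_⟩
      · rw [mul_comp, C_comp, e1, mul_pow, C_mul, ← mul_assoc (C _) (C _) _]
      · rw [mul_comp, C_comp, e2, mul_pow, C_mul, ← mul_assoc (C _) (C _) _]

theorem relate {f₀ f₁ f₂ : k[X]} {c₁ c₂ r₁ r₂ b₁ b₂ : k} (n : ℕ) (hc : c₁ ≠ 0) (hr : r₂ ≠ 0)
    (e1 : f₁.comp (C r₁ * X + C b₁) = C (c₁ ^ n) * f₀)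
    (e2 : f₂.comp (C r₂ * X + C b₂) = C (c₂ ^ n) * f₀) :
    f₂ = C ((c₂ / c₁) ^ n) * f₁.comp (C (r₁ / r₂) * X + C (b₁ - r₁ / r₂ * b₂)) := by
  have hinv : (C r₂ * X + C b₂).comp (C r₂⁻¹ * X + C (- (r₂⁻¹ * b₂))) = X := by
    have : (C r₂ * C r₂⁻¹ : k[X]) = 1 := by rw [← C_mul, mul_inv_cancel₀ hr, C_1]
    simp only [add_comp, mul_comp, C_comp, X_comp, map_neg, map_mul]
    linear_combination (X - C b₂) * this
  have e3 : f₂ = C (c₂ ^ n) * f₀.comp (C r₂⁻¹ * X + C (- (r₂⁻¹ * b₂))) := by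
    have := congrArg (fun p => p.comp (C r₂⁻¹ * X + C (- (r₂⁻¹ * b₂)))) e2
    simpa only [comp_assoc, hinv, comp_X, mul_comp, C_comp] using this
  have e4 : C (c₁ ^ n) * f₀.comp (C r₂⁻¹ * X + C (- (r₂⁻¹ * b₂))) =
      f₁.comp (C (r₁ / r₂) * X + C (b₁ - r₁ / r₂ * b₂)) := by
    have := congrArg (fun p => p.comp (C r₂⁻¹ * X + C (- (r₂⁻¹ * b₂)))) e1
    simp only [comp_assoc, mul_comp, C_comp] at this
    rw [← this]
    congr 1
    simp only [add_comp, mul_comp, C_comp, X_comp, map_neg, map_mul, map_sub, div_eq_mul_inv]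
    ring
  rw [← e4, ← mul_assoc, ← C_mul, ← mul_pow, div_mul_cancel₀ _ hc]
  exact e3

end DS

/-- If `k` is algebraically closed of characteristic different from 2 and 3 and `M = 3` or `4`,
then any two pairs `(f, g)` with `deg f = 2M`, `deg g = 3M`, `f³ ≠ g²` and
`deg(f³ - g²) = M + 1` are related by an affine transformation of the variable and scaling:
`f₂(T) = c² · f₁(aT + b)` and `g₂(T) = c³ · g₁(aT + b)` with `c ≠ 0`, `a ≠ 0`. -/
theorem pair_unique_up_to_affine_transformation (k : Type*) [Field k] [IsAlgClosed k]
    (h2 : (2 : k) ≠ 0) (h3 : (3 : k) ≠ 0)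
    (M : ℕ) (hM : M = 3 ∨ M = 4)
    (f₁ g₁ f₂ g₂ : k[X])
    (hf₁ : f₁.natDegree = 2 * M) (hg₁ : g₁.natDegree = 3 * M)
    (hne₁ : f₁ ^ 3 ≠ g₁ ^ 2) (hd₁ : (f₁ ^ 3 - g₁ ^ 2).natDegree = M + 1)
    (hf₂ : f₂.natDegree = 2 * M) (hg₂ : g₂.natDegree = 3 * M)
    (hne₂ : f₂ ^ 3 ≠ g₂ ^ 2) (hd₂ : (f₂ ^ 3 - g₂ ^ 2).natDegree = M + 1) :
    ∃ c a b : k, c ≠ 0 ∧ a ≠ 0 ∧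
      f₂ = C (c ^ 2) * f₁.comp (C a * X + C b) ∧
      g₂ = C (c ^ 3) * g₁.comp (C a * X + C b) := by
  obtain ⟨f₀, g₀, H⟩ := DS.normal h2 h3 M hM
  obtain ⟨c₁, r₁, b₁, hc₁, hr₁, e₁, e₁'⟩ := H f₁ g₁ hf₁ hg₁ hne₁ hd₁
  obtain ⟨c₂, r₂, b₂, hc₂, hr₂, e₂, e₂'⟩ := H f₂ g₂ hf₂ hg₂ hne₂ hd₂
  exact ⟨c₂ / c₁, r₁ / r₂, b₁ - r₁ / r₂ * b₂, div_ne_zero hc₂ hc₁, div_ne_zero hr₁ hr₂,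
    DS.relate 2 hc₁ hr₂ e₁ e₂, DS.relate 3 hc₁ hr₂ e₁' e₂'⟩
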